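/- Let B be a translation invariant differentiation basis on ℝ², let f ∈ L¹(ℝ²) with support contained in (0,1)², and let r > 0, ε > 0, β ∈ (0,1). Then the set R_B^r(f,ε,β) = {γ ∈ Γ₂ : the Lebesgue outer measure of {x ∈ ℝ² : N^r_{B(γ)}(f)(x) > ε} exceeds β} is open in Γ₂, where N^r_H(f)(x) = sup{ (1/|R|)∫_R f : R ∈ H(x), diam R < r }. -/

import Mathlib

open MeasureTheory Filter Set Topology

noncomputable section

/-- A differentiation basis on the plane (identified with `ℂ`): to each point `x` it assigns a
family of bounded measurable sets of positive measure containing `x`, admitting a sequence of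
sets whose diameters tend to `0`. -/
structure DiffBasis where
  sets : ℂ → Set (Set ℂ)
  bounded : ∀ x, ∀ R ∈ sets x, Bornology.IsBounded R
  measurable : ∀ x, ∀ R ∈ sets x, MeasurableSet R
  pos_measure : ∀ x, ∀ R ∈ sets x, 0 < volume R
  mem_self : ∀ x, ∀ R ∈ sets x, x ∈ R
  shrink : ∀ x, ∃ Rk : ℕ → Set ℂ, (∀ k, Rk k ∈ sets x) ∧
    Tendsto (fun k => Metric.diam (Rk k)) atTop (nhds 0)

/-- Translation invariance of a differentiation basis. -/
def DiffBasis.TI (B : DiffBasis) : Prop :=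
  ∀ x, B.sets x = (fun R => (fun y => x + y) '' R) '' B.sets 0

/-- The `γ`-rotated family of a set family: each `R ∈ S x` is rotated by `γ` around `x`. -/
def rotSets (S : ℂ → Set (Set ℂ)) (γ : Circle) : ℂ → Set (Set ℂ) :=
  fun x => (fun R => (fun y => x + (γ : ℂ) * (y - x)) '' R) '' S x

/-- The filter of "sets from the family with diameter tending to zero". -/
def basisFilter (F : Set (Set ℂ)) : Filter (Set ℂ) :=
  ⨅ r : {r : ℝ // 0 < r}, Filter.principal {R ∈ F | Metric.diam R < r.1}

/-- The average `(1/|R|) ∫_R f`. -/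
def avgI (f : ℂ → ℝ) (R : Set ℂ) : ℝ := (volume R).toReal⁻¹ * ∫ z in R, f z

/-- The upper derivative of `∫ f` with respect to the family `S` at `x`. -/
def upperD (S : ℂ → Set (Set ℂ)) (f : ℂ → ℝ) (x : ℂ) : EReal :=
  Filter.limsup (fun R => ((avgI f R : ℝ) : EReal)) (basisFilter (S x))

/-- The lower derivative of `∫ f` with respect to the family `S` at `x`. -/
def lowerD (S : ℂ → Set (Set ℂ)) (f : ℂ → ℝ) (x : ℂ) : EReal :=
  Filter.liminf (fun R => ((avgI f R : ℝ) : EReal)) (basisFilter (S x))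

/-- `∫ f` is differentiable with respect to the family `S`. -/
def Differentiates (S : ℂ → Set (Set ℂ)) (f : ℂ → ℝ) : Prop :=
  ∀ᵐ x : ℂ, upperD S f x = ((f x : ℝ) : EReal) ∧ lowerD S f x = ((f x : ℝ) : EReal)

/-- The open unit square `(0,1)²`. -/
def unitSquare : Set ℂ := {z | z.re ∈ Set.Ioo (0:ℝ) 1 ∧ z.im ∈ Set.Ioo (0:ℝ) 1}

/-- `N^r_H(f)(x)`: the supremum of `(1/|R|)∫_R f` over `R ∈ H(x)` with `diam R < r`. -/
def Nr (S : ℂ → Set (Set ℂ)) (f : ℂ → ℝ) (r : ℝ) (x : ℂ) : EReal :=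
  ⨆ R : {R : Set ℂ // R ∈ S x ∧ Metric.diam R < r}, ((avgI f R.1 : ℝ) : EReal)

/-- The rigid motion `y ↦ x + γ y`. -/
def rigid (γ : Circle) (x y : ℂ) : ℂ := x + (γ : ℂ) * y

lemma rigid_isometry (γ : Circle) (x : ℂ) : Isometry (rigid γ x) := by
  have h : rigid γ x = (fun z => x + z) ∘ (rotation γ) := by
    funext y; simp [rigid, rotation_apply]
  rw [h]
  exact (isometry_add_left x).comp (rotation γ).isometry

lemma rigid_mp (γ : Circle) (x : ℂ) : MeasurePreserving (rigid γ x) volume volume := by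
  have h : rigid γ x = (fun z => x + z) ∘ (rotation γ) := by
    funext y; simp [rigid, rotation_apply]
  rw [h]
  exact (measurePreserving_add_left volume x).comp (rotation γ).measurePreserving

lemma rigid_emb (γ : Circle) (x : ℂ) : MeasurableEmbedding (rigid γ x) :=
  (rigid_isometry γ x).isClosedEmbedding.measurableEmbedding

lemma avgI_rigid (f : ℂ → ℝ) (R : Set ℂ) (γ : Circle) (x : ℂ) :
    avgI f (rigid γ x '' R) = (volume R).toReal⁻¹ * ∫ y in R, f (rigid γ x y) := by
  unfold avgI
  rw [(rigid_mp γ x).setIntegral_image_emb (rigid_emb γ x)]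
  congr 3
  have := (rigid_mp γ x).measure_preimage_emb (rigid_emb γ x) (rigid γ x '' R)
  rw [Set.preimage_image_eq _ (rigid_isometry γ x).injective] at this
  exact this.symm

lemma continuous_avg (f : ℂ → ℝ) (hf : Integrable f) (R : Set ℂ)
    (hb : Bornology.IsBounded R) :
    Continuous (fun p : Circle × ℂ => ∫ y in R, f (rigid p.1 p.2 y)) := by
  have hfin : IsFiniteMeasure (volume.restrict R) :=
    ⟨by simpa using hb.measure_lt_top⟩
  refine continuous_of_uniform_approx_of_continuous ?_
  intro u hu
  obtain ⟨δ, hδ, hsub⟩ := Metric.mem_uniformity_dist.1 hu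
  obtain ⟨φ, hφc, hφ, hφcont, hφi⟩ :=
    hf.exists_hasCompactSupport_integral_sub_le (half_pos hδ)
  obtain ⟨C, hC⟩ := hφcont.bounded_above_of_compact_support hφc
  refine ⟨fun p => ∫ y in R, φ (rigid p.1 p.2 y), ?_, ?_⟩
  · refine continuous_of_dominated (bound := fun _ => C) ?_ ?_ (integrable_const C) ?_
    · intro p
      exact (hφcont.comp (rigid_isometry p.1 p.2).continuous).aestronglyMeasurable
    · intro p
      exact Eventually.of_forall fun y => hC _
    · refine Eventually.of_forall fun y => hφcont.comp ?_
      unfold rigid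
      fun_prop
  · rintro ⟨γ, x⟩
    apply hsub
    have mp := rigid_mp γ x
    have i1 : Integrable (fun y => f (rigid γ x y)) := mp.integrable_comp_of_integrable hf
    have i2 : Integrable (fun y => φ (rigid γ x y)) := mp.integrable_comp_of_integrable hφi
    rw [Real.dist_eq]
    dsimp only
    rw [← integral_sub i1.integrableOn i2.integrableOn]
    calc |∫ y in R, (f (rigid γ x y) - φ (rigid γ x y))|
        ≤ ∫ y in R, ‖f (rigid γ x y) - φ (rigid γ x y)‖ := by
          rw [← Real.norm_eq_abs]; exact norm_integral_le_integral_norm _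
      _ ≤ ∫ y, ‖f (rigid γ x y) - φ (rigid γ x y)‖ :=
          setIntegral_le_integral (i1.sub i2).norm (Eventually.of_forall fun y => norm_nonneg _)
      _ = ∫ z, ‖f z - φ z‖ := mp.integral_comp (rigid_emb γ x) (fun z => ‖f z - φ z‖)
      _ ≤ δ / 2 := hφ
      _ < δ := half_lt_self hδ

lemma lt_Nr_iff (B : DiffBasis) (hB : B.TI) (f : ℂ → ℝ) (r ε : ℝ) (γ : Circle) (x : ℂ) :
    (ε : EReal) < Nr (rotSets B.sets γ) f r x ↔
      ∃ R ∈ B.sets 0, Metric.diam R < r ∧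
        ε < (volume R).toReal⁻¹ * ∫ y in R, f (rigid γ x y) := by
  have key : ∀ R : Set ℂ, (fun y => x + (γ : ℂ) * (y - x)) '' ((fun y => x + y) '' R)
      = rigid γ x '' R := by
    intro R
    rw [Set.image_image]
    simp only [add_sub_cancel_left]
    rfl
  have hs : ∀ Q, Q ∈ rotSets B.sets γ x ↔ ∃ R ∈ B.sets 0, rigid γ x '' R = Q := by
    intro Q
    unfold rotSets
    rw [hB x, Set.image_image]
    simp only [key, Set.mem_image]
  unfold Nr
  rw [lt_iSup_iff]
  constructor
  · rintro ⟨⟨Q, hQ, hd⟩, h⟩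
    obtain ⟨R, hR, rfl⟩ := (hs Q).1 hQ
    refine ⟨R, hR, ?_, ?_⟩
    · rwa [(rigid_isometry γ x).diam_image] at hd
    · rw [← avgI_rigid]; exact_mod_cast h
  · rintro ⟨R, hR, hd, h⟩
    refine ⟨⟨rigid γ x '' R, (hs _).2 ⟨R, hR, rfl⟩, ?_⟩, ?_⟩
    · rwa [(rigid_isometry γ x).diam_image]
    · rw [← avgI_rigid] at h; exact_mod_cast h

/-- for a translation invariant basis `B`, `f ∈ L¹` supported in `(0,1)²`, and
`r > 0`, `ε > 0`, `β ∈ (0,1)`, the set `R_B^r(f,ε,β)` of rotations `γ` for which the outer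
measure of `{N^r_{B(γ)}(f) > ε}` exceeds `β` is open in `Γ₂`. -/
theorem Rr_set_isOpen (B : DiffBasis) (hB : B.TI) (f : ℂ → ℝ) (hf : Integrable f)
    (hsupp : Function.support f ⊆ unitSquare) (r ε β : ℝ) (hr : 0 < r) (hε : 0 < ε)
    (hβ : β ∈ Set.Ioo (0:ℝ) 1) :
    IsOpen {γ : Circle |
      ENNReal.ofReal β < volume {x : ℂ | (ε : EReal) < Nr (rotSets B.sets γ) f r x}} := by
  have hE : IsOpen {p : Circle × ℂ | ∃ R ∈ B.sets 0, Metric.diam R < r ∧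
        ε < (volume R).toReal⁻¹ * ∫ y in R, f (rigid p.1 p.2 y)} := by
    have : {p : Circle × ℂ | ∃ R ∈ B.sets 0, Metric.diam R < r ∧
        ε < (volume R).toReal⁻¹ * ∫ y in R, f (rigid p.1 p.2 y)} =
        ⋃ R ∈ {R | R ∈ B.sets 0 ∧ Metric.diam R < r},
          {p : Circle × ℂ | ε < (volume R).toReal⁻¹ * ∫ y in R, f (rigid p.1 p.2 y)} := by
      ext p; simp [and_assoc]
    rw [this]
    refine isOpen_biUnion fun R hR => ?_
    exact isOpen_lt continuous_const
      (continuous_const.mul (continuous_avg f hf R (B.bounded 0 R hR.1)))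
  simp only [lt_Nr_iff B hB]
  rw [isOpen_iff_mem_nhds]
  intro γ hγ
  have hS : IsOpen {x : ℂ | ∃ R ∈ B.sets 0, Metric.diam R < r ∧
        ε < (volume R).toReal⁻¹ * ∫ y in R, f (rigid γ x y)} :=
    hE.preimage (Continuous.prodMk_right γ)
  obtain ⟨K, hKS, hK, hlt⟩ := hS.exists_lt_isCompact hγ
  obtain ⟨U, V, hU, -, hγU, hKV, hUV⟩ := generalized_tube_lemma (isCompact_singleton (x := γ)) hK hE
    (by rintro ⟨a, x⟩ ⟨ha, hx⟩
        obtain rfl : a = γ := ha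
        exact hKS hx)
  filter_upwards [hU.mem_nhds (hγU rfl)] with σ hσ
  refine lt_of_lt_of_le hlt (measure_mono fun x hx => ?_)
  exact hUV (Set.mk_mem_prod hσ (hKV hx))

end
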